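/- Let Γ_n be the directed graph of isomorphism classes of cubic graphs on 2n vertices connected by Whitehead moves, and let A_n be its adjacency matrix. Then the spectral radius ρ_n of A_n is a Perron number, and the number of directed paths of length ℓ in Γ_n grows asymptotically like ρ_n^ℓ as ℓ → ∞ (i.e., there is a constant C_n > 0 with (number of directed paths of length ℓ in Γ_n)/ρ_n^ℓ → C_n). -/

import Mathlib

/-! Cubic multigraphs in the dart (half-edge) model, Whitehead moves,
and the "graph of graphs" `Γ_n`. -/

/-- A cubic multigraph on the `2 * n` vertices `Fin (2 * n)`, in the dart (half-edge) model:
darts are `Fin (6 * n)`, `dinv` is the fixed-point-free involution exchanging the two darts of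
each edge, and `vert` assigns to each dart its base vertex.  Loops and multiple edges are
allowed; `regular` says every vertex carries exactly three darts. -/
structure CubicGraph (n : ℕ) where
  vert : Fin (6 * n) → Fin (2 * n)
  dinv : Fin (6 * n) → Fin (6 * n)
  dinv_invol : ∀ d, dinv (dinv d) = d
  dinv_ne : ∀ d, dinv d ≠ d
  regular : ∀ v : Fin (2 * n), (Finset.univ.filter fun d => vert d = v).card = 3

namespace CubicGraph

variable {n : ℕ}

/-- Two darts are joined if they can be connected by a chain of
"same vertex" / "other half of the same edge" steps. -/
def Reach (g : CubicGraph n) : Fin (6 * n) → Fin (6 * n) → Prop :=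
  Relation.ReflTransGen fun a b => g.vert a = g.vert b ∨ g.dinv a = b

/-- Connectivity of a cubic multigraph. -/
def Connected (g : CubicGraph n) : Prop := ∀ d d', g.Reach d d'

/-- The edge of the dart `d` is a loop. -/
def IsLoop (g : CubicGraph n) (d : Fin (6 * n)) : Prop := g.vert (g.dinv d) = g.vert d

instance (g : CubicGraph n) (d : Fin (6 * n)) : Decidable (g.IsLoop d) :=
  inferInstanceAs (Decidable (_ = _))

lemma card_filter_comp_swap (g : CubicGraph n) (q r : Fin (6 * n)) (v : Fin (2 * n)) :
    (Finset.univ.filter fun d => g.vert (Equiv.swap q r d) = v).card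
      = (Finset.univ.filter fun d => g.vert d = v).card := by
  refine Finset.card_bij (fun d _ => Equiv.swap q r d) ?_ ?_ ?_
  · intro a ha
    simp only [Finset.mem_filter, Finset.mem_univ, true_and] at ha ⊢
    exact ha
  · intro a _ b _ h
    exact (Equiv.swap q r).injective h
  · intro b hb
    simp only [Finset.mem_filter, Finset.mem_univ, true_and] at hb
    exact ⟨Equiv.swap q r b, by simp [hb], by simp⟩

/-- Exchange the base vertices of the two darts `q` and `r`, keeping everything else. -/
def swapDarts (g : CubicGraph n) (q r : Fin (6 * n)) : CubicGraph n where
  vert := fun d => g.vert (Equiv.swap q r d)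
  dinv := g.dinv
  dinv_invol := g.dinv_invol
  dinv_ne := g.dinv_ne
  regular := fun v => (g.card_filter_comp_swap q r v).trans (g.regular v)

/-- The darts based at the same vertex as `x`, other than `x` itself. -/
def othersAt (g : CubicGraph n) (x : Fin (6 * n)) : Finset (Fin (6 * n)) :=
  (Finset.univ.filter fun d => g.vert d = g.vert x).erase x

lemma othersAt_nonempty (g : CubicGraph n) (x : Fin (6 * n)) :
    (g.othersAt x).Nonempty := by
  have hx : x ∈ Finset.univ.filter fun d => g.vert d = g.vert x := by simp
  have h : (g.othersAt x).card = 2 := by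
    rw [othersAt, Finset.card_erase_of_mem hx, g.regular]
  rw [← Finset.card_pos, h]
  norm_num

def oMin (g : CubicGraph n) (x : Fin (6 * n)) : Fin (6 * n) :=
  (g.othersAt x).min' (g.othersAt_nonempty x)

def oMax (g : CubicGraph n) (x : Fin (6 * n)) : Fin (6 * n) :=
  (g.othersAt x).max' (g.othersAt_nonempty x)

/-- The two Whitehead moves (indexed by `i : Fin 2`) performed on the edge containing the dart
`x`.  On a loop the move leaves the graph unchanged; on a non-loop edge the two darts at the
endpoints of the edge other than the edge's own darts are re-attached in one of the two
possible new ways (realized by transporting one dart from each endpoint to the other). -/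
def wh (g : CubicGraph n) (i : Fin 2) (x : Fin (6 * n)) : CubicGraph n :=
  if g.IsLoop x then g
  else if i = 0 then g.swapDarts (g.oMax x) (g.oMin (g.dinv x))
  else g.swapDarts (g.oMax x) (g.oMax (g.dinv x))

/-- An isomorphism of cubic multigraphs: a bijection of darts together with a compatible
bijection of vertices, commuting with the edge involutions. -/
structure Iso (g₁ g₂ : CubicGraph n) where
  dartEquiv : Fin (6 * n) ≃ Fin (6 * n)
  vertEquiv : Fin (2 * n) ≃ Fin (2 * n)
  map_dinv : ∀ d, g₂.dinv (dartEquiv d) = dartEquiv (g₁.dinv d)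
  map_vert : ∀ d, g₂.vert (dartEquiv d) = vertEquiv (g₁.vert d)

def IsIsomorphic (g₁ g₂ : CubicGraph n) : Prop := Nonempty (Iso g₁ g₂)

/-- Reachability avoiding the edge of the dart `x` (i.e. in the graph with that edge removed). -/
def ReachAvoiding (g : CubicGraph n) (x : Fin (6 * n)) :
    Fin (6 * n) → Fin (6 * n) → Prop :=
  Relation.ReflTransGen fun a b =>
    g.vert a = g.vert b ∨ (g.dinv a = b ∧ a ≠ x ∧ a ≠ g.dinv x)

/-- The edge of `x` is a bridge: removing it disconnects the graph. -/
def IsBridge (g : CubicGraph n) (x : Fin (6 * n)) : Prop :=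
  ¬ ∀ d d', g.ReachAvoiding x d d'

/-- A (connected) graph is bridged if it has at least one bridge. -/
def Bridged (g : CubicGraph n) : Prop := ∃ x, g.IsBridge x

/-- A graph is bridgeless if it has no bridge. -/
def Bridgeless (g : CubicGraph n) : Prop := ∀ x, ¬ g.IsBridge x

/-- `c` lists consecutive darts of a cycle of length `k`: the vertices visited are pairwise
distinct, the end of each dart's edge is the base of the next one (cyclically), and the `k`
edges used are pairwise distinct. -/
def IsCycle (g : CubicGraph n) (k : ℕ) (c : Fin k → Fin (6 * n)) : Prop :=
  (∀ i : Fin k,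
    g.vert (g.dinv (c i)) = g.vert (c ⟨(i.1 + 1) % k, Nat.mod_lt _ i.pos⟩)) ∧
  Function.Injective (fun i => g.vert (c i)) ∧
  ∀ i j : Fin k, c j ≠ g.dinv (c i)

/-- The cycle `c` is indecomposable (induced): no edge of `g` other than the cycle's own
edges joins two vertices of the cycle. -/
def Indecomposable (g : CubicGraph n) (k : ℕ) (c : Fin k → Fin (6 * n)) : Prop :=
  ∀ d, (∃ i, g.vert d = g.vert (c i)) → (∃ j, g.vert (g.dinv d) = g.vert (c j)) →
    ∃ i, d = c i ∨ d = g.dinv (c i)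

/-- The girth: the least length of a cycle. -/
noncomputable def girth (g : CubicGraph n) : ℕ :=
  sInf {k | 0 < k ∧ ∃ c : Fin k → Fin (6 * n), g.IsCycle k c}

/-- The only cycles of the graph are loops. -/
def OnlyLoopCycles (g : CubicGraph n) : Prop :=
  ∀ k, 2 ≤ k → ∀ c : Fin k → Fin (6 * n), ¬ g.IsCycle k c

/-- The number of darts lying on loops (each loop contributes two darts). -/
def loopCount (g : CubicGraph n) : ℕ :=
  (Finset.univ.filter fun d => g.IsLoop d).card

end CubicGraph

instance {n : ℕ} : Finite (CubicGraph n) := by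
  have hinj : Function.Injective fun g : CubicGraph n => (g.vert, g.dinv) := by
    rintro ⟨v₁, i₁, _, _, _⟩ ⟨v₂, i₂, _, _, _⟩ h
    simp only [Prod.mk.injEq] at h
    obtain ⟨h₁, h₂⟩ := h
    subst h₁; subst h₂; rfl
  exact Finite.of_injective _ hinj

/-- Isomorphism of connected cubic graphs. -/
def cgIso {n : ℕ} (g₁ g₂ : {g : CubicGraph n // g.Connected}) : Prop :=
  CubicGraph.IsIsomorphic g₁.1 g₂.1

/-- The vertex set of the graph of graphs `Γ_n`: isomorphism classes of connected cubic
multigraphs on `2 * n` vertices. -/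
abbrev GammaV (n : ℕ) := Quot (@cgIso n)

/-- The number of directed edges of `Γ_n` from the class `u` to the class `v`: one edge for
each Whitehead move of a representative of `u` whose result lies in the class `v`.  A move
specification is a pair `(i, x)` of a move type `i : Fin 2` and a dart `x`; each of the two
Whitehead moves of each edge is counted by exactly two specifications (one for each of the
two darts of the edge), whence the division by `2`. -/
noncomputable def edgeMult (n : ℕ) (u v : GammaV n) : ℕ :=
  Nat.card {p : Fin 2 × Fin (6 * n) //
    CubicGraph.IsIsomorphic ((Quot.out u).1.wh p.1 p.2) (Quot.out v).1} / 2

/-- The sum of out-degrees of the classes in `S` (every class has out-degree `6 * n`: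
two Whitehead moves for each of the `3 * n` edges). -/
noncomputable def dOut (n : ℕ) (S : Set (GammaV n)) : ℕ :=
  Nat.card {q : GammaV n × Fin 2 × Fin (6 * n) // q.1 ∈ S} / 2

/-- The number of directed edges of `Γ_n` from `S` to its complement. -/
noncomputable def boundaryCount (n : ℕ) (S : Set (GammaV n)) : ℕ :=
  Nat.card {q : GammaV n × Fin 2 × Fin (6 * n) // q.1 ∈ S ∧
    ∀ v : GammaV n,
      CubicGraph.IsIsomorphic ((Quot.out q.1).1.wh q.2.1 q.2.2) (Quot.out v).1 → v ∉ S} / 2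

/-- The outer conductance of a set `S` of vertices of `Γ_n`. -/
noncomputable def phiOutSet (n : ℕ) (S : Set (GammaV n)) : ℝ :=
  (boundaryCount n S : ℝ) / min (dOut n S : ℝ) (dOut n Sᶜ : ℝ)

/-- The outer conductance of `Γ_n`: the infimum of the outer conductances of nonempty
proper subsets of vertices. -/
noncomputable def phiOut (n : ℕ) : ℝ :=
  sInf {x : ℝ | ∃ S : Set (GammaV n), S.Nonempty ∧ Sᶜ.Nonempty ∧ x = phiOutSet n S}

/-- The set of classes of bridged cubic graphs. -/
def bridgedSet (n : ℕ) : Set (GammaV n) := {u | (Quot.out u).1.Bridged}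

noncomputable instance {n : ℕ} : Fintype (GammaV n) := Fintype.ofFinite _

noncomputable instance {n : ℕ} : DecidableEq (GammaV n) := Classical.decEq _

/-- The adjacency matrix of `Γ_n`, as a matrix of natural numbers. -/
noncomputable def adjMatN (n : ℕ) : Matrix (GammaV n) (GammaV n) ℕ :=
  fun u v => edgeMult n u v

/-- The adjacency matrix of `Γ_n`, over the reals. -/
noncomputable def adjMatR (n : ℕ) : Matrix (GammaV n) (GammaV n) ℝ :=
  fun u v => (edgeMult n u v : ℝ)

/-- The adjacency matrix of `Γ_n`, over the complex numbers. -/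
noncomputable def adjMatC (n : ℕ) : Matrix (GammaV n) (GammaV n) ℂ :=
  fun u v => (edgeMult n u v : ℂ)

/-- The number of directed paths of length `ℓ` in `Γ_n` (entries of the `ℓ`-th power of the
adjacency matrix, summed). -/
noncomputable def pathCount (n ℓ : ℕ) : ℝ :=
  ∑ u : GammaV n, ∑ v : GammaV n, (adjMatR n ^ ℓ) u v

/-- A Perron number: a real algebraic integer `ρ > 1` all of whose other Galois conjugates
have modulus strictly less than `ρ`. -/
def IsPerron (ρ : ℝ) : Prop :=
  1 < ρ ∧ IsIntegral ℤ ρ ∧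
    ∀ z : ℂ, Polynomial.aeval z (minpoly ℤ ρ) = 0 → z ≠ (ρ : ℂ) → ‖z‖ < ρ

namespace CubicGraph

variable {n : ℕ}

lemma IsIsomorphic.refl (g : CubicGraph n) : g.IsIsomorphic g :=
  ⟨⟨Equiv.refl _, Equiv.refl _, fun _ => rfl, fun _ => rfl⟩⟩

lemma IsIsomorphic.symm {g₁ g₂ : CubicGraph n} : g₁.IsIsomorphic g₂ → g₂.IsIsomorphic g₁ := by
  rintro ⟨e⟩
  refine ⟨⟨e.dartEquiv.symm, e.vertEquiv.symm, fun d => ?_, fun d => ?_⟩⟩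
  · rw [Equiv.eq_symm_apply, ← e.map_dinv, Equiv.apply_symm_apply]
  · rw [Equiv.eq_symm_apply, ← e.map_vert, Equiv.apply_symm_apply]

lemma IsIsomorphic.trans {g₁ g₂ g₃ : CubicGraph n} :
    g₁.IsIsomorphic g₂ → g₂.IsIsomorphic g₃ → g₁.IsIsomorphic g₃ := by
  rintro ⟨e⟩ ⟨f⟩
  exact ⟨⟨e.dartEquiv.trans f.dartEquiv, e.vertEquiv.trans f.vertEquiv,
    fun d => by simp [f.map_dinv, e.map_dinv], fun d => by simp [f.map_vert, e.map_vert]⟩⟩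

lemma mem_othersAt {g : CubicGraph n} {x d : Fin (6 * n)} :
    d ∈ g.othersAt x ↔ d ≠ x ∧ g.vert d = g.vert x := by
  simp [othersAt]

lemma card_othersAt (g : CubicGraph n) (x : Fin (6 * n)) : (g.othersAt x).card = 2 := by
  rw [othersAt, Finset.card_erase_of_mem (by simp), g.regular]

lemma oMin_mem (g : CubicGraph n) (x : Fin (6 * n)) : g.oMin x ∈ g.othersAt x :=
  Finset.min'_mem _ _

lemma oMax_mem (g : CubicGraph n) (x : Fin (6 * n)) : g.oMax x ∈ g.othersAt x :=
  Finset.max'_mem _ _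

lemma oMin_ne_oMax (g : CubicGraph n) (x : Fin (6 * n)) : g.oMin x ≠ g.oMax x :=
  (Finset.min'_lt_max'_of_card _ (by rw [card_othersAt]; norm_num)).ne

lemma eq_or_eq_or_eq_of_vert_eq (g : CubicGraph n) {x d : Fin (6 * n)}
    (h : g.vert d = g.vert x) : d = x ∨ d = g.oMin x ∨ d = g.oMax x := by
  by_cases hd : d = x
  · exact Or.inl hd
  have hsub : {g.oMin x, g.oMax x} ⊆ g.othersAt x := by
    simp [Finset.insert_subset_iff, oMin_mem, oMax_mem]
  have heq := Finset.eq_of_subset_of_card_le hsub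
    (by rw [card_othersAt, Finset.card_pair (g.oMin_ne_oMax x)])
  have hmem : d ∈ g.othersAt x := mem_othersAt.2 ⟨hd, h⟩
  rw [← heq] at hmem
  simpa [hd] using hmem

lemma Reach.symm {g : CubicGraph n} {a b : Fin (6 * n)} (h : g.Reach a b) : g.Reach b a := by
  induction h with
  | refl => exact .refl
  | tail _ hbc ih =>
    refine .head ?_ ih
    rcases hbc with hbc | hbc
    · exact Or.inl hbc.symm
    · exact Or.inr (by rw [← hbc, g.dinv_invol])

/-- Exchanging two darts, one from each end of a non-loop edge, preserves connectivity. -/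
lemma Connected.swapDarts {g : CubicGraph n} (hg : g.Connected) {x q r : Fin (6 * n)}
    (hx : ¬ g.IsLoop x) (hq : q ∈ g.othersAt x) (hr : r ∈ g.othersAt (g.dinv x)) :
    (g.swapDarts q r).Connected := by
  obtain ⟨hqx, hqv⟩ := mem_othersAt.1 hq
  obtain ⟨hrx, hrv⟩ := mem_othersAt.1 hr
  have hx' : g.vert (g.dinv x) ≠ g.vert x := hx
  have hxr : x ≠ r := by rintro rfl; exact hx' hrv.symm
  have hqx' : g.dinv x ≠ q := by rintro rfl; exact hx' hqv
  have vx : (g.swapDarts q r).vert x = g.vert x := by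
    simp [CubicGraph.swapDarts, Equiv.swap_apply_of_ne_of_ne hqx.symm hxr]
  have vx' : (g.swapDarts q r).vert (g.dinv x) = g.vert (g.dinv x) := by
    simp [CubicGraph.swapDarts, Equiv.swap_apply_of_ne_of_ne hqx' hrx.symm]
  have hxx : (g.swapDarts q r).Reach x (g.dinv x) := .single (Or.inr rfl)
  have near : ∀ d, ((g.swapDarts q r).vert d = g.vert x ∨
      (g.swapDarts q r).vert d = g.vert (g.dinv x)) → (g.swapDarts q r).Reach x d := by
    rintro d (hd | hd)
    · exact .single (Or.inl (vx.trans hd.symm))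
    · exact hxx.tail (Or.inl (vx'.trans hd.symm))
  have vert_or : ∀ d, (g.swapDarts q r).vert d = g.vert d ∨
      ((g.swapDarts q r).Reach x d ∧ (g.vert d = g.vert x ∨ g.vert d = g.vert (g.dinv x))) := by
    intro d
    by_cases hdq : d = q
    · subst hdq
      exact Or.inr ⟨near _ (Or.inr (by simp [CubicGraph.swapDarts, hrv])), Or.inl hqv⟩
    by_cases hdr : d = r
    · subst hdr
      exact Or.inr ⟨near _ (Or.inl (by simp [CubicGraph.swapDarts, hqv])), Or.inr hrv⟩
    exact Or.inl (by simp [CubicGraph.swapDarts, Equiv.swap_apply_of_ne_of_ne hdq hdr])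
  have near' : ∀ d, (g.vert d = g.vert x ∨ g.vert d = g.vert (g.dinv x)) →
      (g.swapDarts q r).Reach x d := by
    intro d hd
    rcases vert_or d with h | h
    · exact near d (by rwa [h])
    · exact h.1
  have all : ∀ d, (g.swapDarts q r).Reach x d := by
    intro d
    induction hg x d with
    | refl => exact .refl
    | @tail b c _ hbc ih =>
      rcases hbc with hbc | hbc
      · rcases vert_or b with hb | hb
        · rcases vert_or c with hc | hc
          · exact ih.tail (Or.inl (by rw [hb, hc, hbc]))
          · exact hc.1
        · exact near' c (by rw [← hbc]; exact hb.2)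
      · exact ih.tail (Or.inr hbc)
  exact fun d d' => (all d).symm.trans (all d')

lemma Connected.wh {g : CubicGraph n} (hg : g.Connected) (i : Fin 2) (x : Fin (6 * n)) :
    (g.wh i x).Connected := by
  unfold CubicGraph.wh
  split_ifs with h
  · exact hg
  · exact hg.swapDarts h (g.oMax_mem x) (g.oMin_mem _)
  · exact hg.swapDarts h (g.oMax_mem x) (g.oMax_mem _)

/-- The two darts of an edge give isomorphic Whitehead moves. -/
lemma wh_isIsomorphic_wh_dinv (g : CubicGraph n) (i : Fin 2) (x : Fin (6 * n)) :
    (g.wh i x).IsIsomorphic (g.wh i (g.dinv x)) := by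
  have hloop : g.IsLoop (g.dinv x) ↔ g.IsLoop x := by
    simp only [IsLoop, g.dinv_invol, eq_comm]
  by_cases hx : g.IsLoop x
  · rw [wh, wh, if_pos hx, if_pos (hloop.2 hx)]
    exact .refl g
  by_cases hi : i = 0
  swap
  · rw [wh, wh, if_neg hx, if_neg (fun h => hx (hloop.1 h)), if_neg hi, if_neg hi,
      g.dinv_invol, swapDarts, swapDarts]
    simp only [Equiv.swap_comm (g.oMax (g.dinv x))]
    exact .refl _
  rw [wh, wh, if_neg hx, if_neg (fun h => hx (hloop.1 h)), if_pos hi, if_pos hi, g.dinv_invol]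
  obtain ⟨hMx, hMv⟩ := mem_othersAt.1 (g.oMax_mem x)
  obtain ⟨hmx, hmv⟩ := mem_othersAt.1 (g.oMin_mem x)
  obtain ⟨hMx', hMv'⟩ := mem_othersAt.1 (g.oMax_mem (g.dinv x))
  obtain ⟨hmx', hmv'⟩ := mem_othersAt.1 (g.oMin_mem (g.dinv x))
  have hmM := g.oMin_ne_oMax x
  have hmM' := g.oMin_ne_oMax (g.dinv x)
  have cu := fun d => g.eq_or_eq_or_eq_of_vert_eq (x := x) (d := d)
  have cv := fun d => g.eq_or_eq_or_eq_of_vert_eq (x := g.dinv x) (d := d)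
  have huv : g.vert (g.dinv x) ≠ g.vert x := hx
  refine ⟨⟨Equiv.swap x (g.dinv x), Equiv.swap (g.vert x) (g.vert (g.dinv x)), fun d => ?_,
    fun d => ?_⟩⟩
  · have := g.dinv_invol d
    have := g.dinv_invol x
    simp only [swapDarts, Equiv.swap_apply_def]
    grind
  · simp only [swapDarts]
    generalize g.oMax x = M at *
    generalize g.oMin x = m at *
    generalize g.oMax (g.dinv x) = M' at *
    generalize g.oMin (g.dinv x) = m' at *
    generalize g.dinv x = x' at *
    specialize cu d
    specialize cv d
    simp only [Equiv.swap_apply_def]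
    grind

/-- The edge involution of the necklace: the pair of vertices carrying the darts
`6 * i, …, 6 * i + 5` is joined by two edges, and `6 * i + 5` is joined to the next pair. -/
def necklaceInv (n d : ℕ) : ℕ :=
  if d % 6 = 0 then (if d = 0 then 6 * n - 1 else d - 1)
  else if d % 6 = 1 ∨ d % 6 = 2 then d + 2
  else if d % 6 = 3 ∨ d % 6 = 4 then d - 2
  else if d + 1 = 6 * n then 0 else d + 1

/-- The necklace: `n` pairs of vertices joined by double edges, arranged in a cycle. -/
def necklace (n : ℕ) (hn : 1 ≤ n) : CubicGraph n where
  vert d := ⟨d / 3, by omega⟩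
  dinv d := ⟨necklaceInv n d, by have := d.2; unfold necklaceInv; split_ifs <;> omega⟩
  dinv_invol d := by
    ext
    have := d.2
    dsimp only
    generalize hk : necklaceInv n d = k
    unfold necklaceInv at hk ⊢
    split_ifs at hk <;> split_ifs <;> omega
  dinv_ne d h := by
    have := d.2
    rw [Fin.ext_iff] at h
    dsimp only [necklaceInv] at h
    split_ifs at h <;> omega
  regular v := by
    rw [show (Finset.univ.filter fun d : Fin (6 * n) => (⟨d / 3, by omega⟩ : Fin (2 * n)) = v)
      = {⟨3 * v, by omega⟩, ⟨3 * v + 1, by omega⟩, ⟨3 * v + 2, by omega⟩} by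
        ext d
        simp only [Finset.mem_filter, Finset.mem_univ, true_and, Finset.mem_insert,
          Finset.mem_singleton, Fin.ext_iff]
        omega]
    rw [Finset.card_eq_three]
    exact ⟨_, _, _, by simp, by simp, by simp, rfl⟩

lemma necklace_connected (hn : 1 ≤ n) : (necklace n hn).Connected := by
  have key : ∀ k (hk : k < 6 * n), (necklace n hn).Reach ⟨0, by omega⟩ ⟨k, hk⟩ := by
    intro k
    induction k with
    | zero => exact fun _ => .refl
    | succ k ih =>
      intro hk
      have ih := ih (by omega)
      by_cases h3 : (k + 1) % 3 = 0
      · by_cases h6 : (k + 1) % 6 = 0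
        · refine ih.tail (Or.inr ?_)
          ext
          dsimp only [necklace, necklaceInv]
          split_ifs <;> omega
        · have hv : (necklace n hn).vert ⟨k, by omega⟩ =
              (necklace n hn).vert ⟨k - 1, by omega⟩ := by
            ext
            dsimp only [necklace]
            omega
          refine (ih.tail (Or.inl hv)).tail (Or.inr ?_)
          ext
          dsimp only [necklace, necklaceInv]
          split_ifs <;> omega
      · refine ih.tail (Or.inl ?_)
        ext
        dsimp only [necklace]
        omega
  exact fun d d' => (key d.1 d.2).symm.trans (key d'.1 d'.2)

end CubicGraph

lemma cgIso_equivalence (n : ℕ) : Equivalence (@cgIso n) :=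
  ⟨fun g => .refl g.1, fun h => h.symm, fun h h' => h.trans h'⟩

lemma GammaV.mk_eq_iff {n : ℕ} {g : {g : CubicGraph n // g.Connected}} {v : GammaV n} :
    Quot.mk cgIso g = v ↔ g.1.IsIsomorphic (Quot.out v).1 := by
  conv_lhs => rw [← Quot.out_eq v]
  rw [Quot.eq, (cgIso_equivalence n).eqvGen_iff]
  rfl

lemma GammaV.nonempty {n : ℕ} (hn : 1 ≤ n) : Nonempty (GammaV n) :=
  ⟨Quot.mk _ ⟨_, CubicGraph.necklace_connected hn⟩⟩

open scoped Classical in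
/-- Move specifications leading from `u` to `v` come in pairs, one for each dart of the edge. -/
lemma two_mul_edgeMult (n : ℕ) (u v : GammaV n) :
    2 * edgeMult n u v = (Finset.univ.filter fun p : Fin 2 × Fin (6 * n) =>
      CubicGraph.IsIsomorphic ((Quot.out u).1.wh p.1 p.2) (Quot.out v).1).card := by
  rw [edgeMult, Nat.card_eq_fintype_card, Fintype.card_subtype]
  refine Nat.mul_div_cancel' ?_
  rw [← ZMod.natCast_eq_zero_iff, Finset.card_eq_sum_ones, Nat.cast_sum]
  refine Finset.sum_involution (fun p _ => (p.1, (Quot.out u).1.dinv p.2)) ?_ ?_ ?_ ?_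
  · intro p _
    decide
  · intro p _ _ h
    exact (Quot.out u).1.dinv_ne _ (congrArg Prod.snd h)
  · intro p hp
    rw [Finset.mem_filter] at hp ⊢
    exact ⟨Finset.mem_univ _, (CubicGraph.wh_isIsomorphic_wh_dinv _ _ _).symm.trans hp.2⟩
  · intro p _
    simp [CubicGraph.dinv_invol]

/-- Every vertex of `Γ_n` has out-degree `6 * n`. -/
lemma sum_edgeMult (n : ℕ) (u : GammaV n) : ∑ v, edgeMult n u v = 6 * n := by
  classical
  have h : ∑ v, 2 * edgeMult n u v = 2 * (6 * n) := by
    simp_rw [two_mul_edgeMult]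
    have := Finset.card_eq_sum_card_fiberwise (s := (Finset.univ : Finset (Fin 2 × Fin (6 * n))))
      (t := Finset.univ)
      (f := fun p => (Quot.mk cgIso ⟨_, (Quot.out u).2.wh p.1 p.2⟩ : GammaV n))
      (fun _ _ => Finset.mem_coe.2 (Finset.mem_univ _))
    simp only [GammaV.mk_eq_iff, Finset.card_univ, Fintype.card_prod, Fintype.card_fin] at this
    exact this.symm
  rw [← Finset.mul_sum] at h
  omega

namespace Matrix

variable {ι : Type*} [Fintype ι] [DecidableEq ι]

/-- A constant row sum is an eigenvalue. -/
lemma mem_spectrum_of_row_sum_eq {K : Type*} [Field K] [Nonempty ι] {A : Matrix ι ι K} {r : K}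
    (h : ∀ i, ∑ j, A i j = r) : r ∈ spectrum K A := by
  rw [← spectrum_toLin', ← Module.End.hasEigenvalue_iff_mem_spectrum]
  refine Module.End.hasEigenvalue_of_hasEigenvector (x := 1)
    (Module.End.hasEigenvector_iff.2 ⟨Module.End.mem_eigenspace_iff.2 ?_, one_ne_zero⟩)
  ext i
  simp [mulVec, dotProduct, h]

/-- Eigenvalues are bounded by any common bound on the absolute row sums. -/
lemma norm_le_of_mem_spectrum_of_row_sum_le {K : Type*} [NormedField K] {A : Matrix ι ι K}
    {r : ℝ} (h : ∀ i, ∑ j, ‖A i j‖ ≤ r) {μ : K} (hμ : μ ∈ spectrum K A) : ‖μ‖ ≤ r := by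
  rw [← spectrum_toLin', ← Module.End.hasEigenvalue_iff_mem_spectrum] at hμ
  obtain ⟨k, hk⟩ := eigenvalue_mem_ball hμ
  rw [mem_closedBall_iff_norm] at hk
  calc ‖μ‖ ≤ ‖A k k‖ + ‖μ - A k k‖ := norm_le_norm_add_norm_sub' _ _
    _ ≤ ‖A k k‖ + ∑ j ∈ Finset.univ.erase k, ‖A k j‖ := by gcongr
    _ = ∑ j, ‖A k j‖ := Finset.add_sum_erase _ (fun j => ‖A k j‖) (Finset.mem_univ k)
    _ ≤ r := h k

lemma row_sum_pow_eq {R : Type*} [CommSemiring R] {A : Matrix ι ι R} {r : R}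
    (h : ∀ i, ∑ j, A i j = r) (k : ℕ) (i : ι) : ∑ j, (A ^ k) i j = r ^ k := by
  induction k generalizing i with
  | zero => simp [one_apply]
  | succ k ih =>
    simp_rw [pow_succ', mul_apply]
    rw [Finset.sum_comm]
    simp_rw [← Finset.mul_sum, ih, ← Finset.sum_mul, h]

end Matrix

/-- Every integer greater than `1` is a Perron number. -/
lemma isPerron_intCast {m : ℤ} (hm : 1 < m) : IsPerron (m : ℝ) := by
  have hm_int : IsIntegral ℤ (m : ℝ) := isIntegral_algebraMap (R := ℤ) (x := m)
  refine ⟨by exact_mod_cast hm, hm_int, fun z hz hne => absurd ?_ hne⟩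
  have hdvd : minpoly ℤ (m : ℝ) ∣ Polynomial.X - Polynomial.C m :=
    minpoly.isIntegrallyClosed_dvd hm_int (by simp)
  have := Polynomial.aeval_eq_zero_of_dvd_aeval_eq_zero hdvd hz
  simpa [sub_eq_zero] using this

/-- The spectral radius `ρ_n` of the adjacency matrix of `Γ_n` is a Perron
number, and the number of directed paths of length `ℓ` in `Γ_n` is asymptotic to `ρ_n ^ ℓ`. -/
theorem spectralRadius_isPerron_and_pathCount_asymptotics (n : ℕ) (hn : 1 ≤ n) :
    ∃ ρ : ℝ, (ρ : ℂ) ∈ spectrum ℂ (adjMatC n) ∧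
      (∀ μ ∈ spectrum ℂ (adjMatC n), ‖μ‖ ≤ ρ) ∧
      IsPerron ρ ∧
      ∃ C : ℝ, 0 < C ∧
        Filter.Tendsto (fun ℓ : ℕ => pathCount n ℓ / ρ ^ ℓ) Filter.atTop (nhds C) := by
  have : Nonempty (GammaV n) := GammaV.nonempty hn
  have hsum : ∀ u : GammaV n, ∑ v, adjMatR n u v = (6 * n : ℕ) := fun u => by
    simp_rw [adjMatR, ← Nat.cast_sum, sum_edgeMult]
  refine ⟨(6 * n : ℕ), ?_, fun μ hμ => ?_, ?_, Fintype.card (GammaV n), ?_, ?_⟩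
  · refine Matrix.mem_spectrum_of_row_sum_eq fun u => ?_
    simp_rw [adjMatC, ← Nat.cast_sum, sum_edgeMult, Complex.ofReal_natCast]
  · refine Matrix.norm_le_of_mem_spectrum_of_row_sum_le (fun u => ?_) hμ
    simp_rw [adjMatC, Complex.norm_natCast, ← Nat.cast_sum, sum_edgeMult, le_refl]
  · have := isPerron_intCast (m := (6 * n : ℕ)) (by omega)
    rwa [Int.cast_natCast] at this
  · exact_mod_cast Fintype.card_pos
  · have hpow : ((6 * n : ℕ) : ℝ) ≠ 0 := by
      have : 6 * n ≠ 0 := by omega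
      exact_mod_cast this
    refine tendsto_const_nhds.congr fun ℓ => ?_
    simp_rw [pathCount, Matrix.row_sum_pow_eq hsum]
    rw [Finset.sum_const, Finset.card_univ, nsmul_eq_mul,
      mul_div_cancel_right₀ _ (pow_ne_zero _ hpow)]
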